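/- Let n ≥ 1. Summing over all sequences of partitions ∅ = λ^{(0)} ≺ λ^{(1)} ≺ ⋯ ≺ λ^{(2n)} such that the central partition satisfies λ^{(2n)}_{2k−1} = λ^{(2n)}_{2k} for all k ≥ 1 (i.e. over symmetric plane partitions in the 2n×2n box whose central diagonal slice has even conjugate), one has Σ ∏_{i=2,4,6,…,2n} (1 − t^{λ^{(2n)}_i − i + 2n + 1}) · ∏_{j=1}^{2n} x_j^{|λ^{(j)}|−|λ^{(j−1)}|} = (1/Δ(x)_{2n}) · Pf[ (x_i − x_j)(1−t) / ((1 − x_i x_j)(1 − t x_i x_j)) ]_{1≤i<j≤2n}. -/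

import Mathlib

noncomputable section

open scoped BigOperators

/-- The Vandermonde product `Δ(x)ₙ = ∏_{i<j} (x i - x j)`. -/
def vprod {n : ℕ} (x : Fin n → ℂ) : ℂ :=
  ∏ i : Fin n, ∏ j ∈ Finset.Ioi i, (x i - x j)

/-- `Interlace a b` means `a ≻ b`, i.e. `a₁ ≥ b₁ ≥ a₂ ≥ b₂ ≥ ⋯`. -/
def Interlace {m : ℕ} (a b : Fin m → ℕ) : Prop :=
  (∀ i, b i ≤ a i) ∧ ∀ i : ℕ, ∀ h : i + 1 < m, a ⟨i + 1, h⟩ ≤ b ⟨i, by omega⟩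

/-- The weight `|λ| = Σᵢ λᵢ` of a partition. -/
def wt {m : ℕ} (l : Fin m → ℕ) : ℕ := ∑ i, l i

/-- The element of `Fin (2*n)` at even position `2k`. -/
def fe (n : ℕ) (k : Fin n) : Fin (2 * n) :=
  ⟨2 * (k : ℕ), by have := k.isLt; omega⟩

/-- The element of `Fin (2*n)` at odd position `2k+1`. -/
def fo (n : ℕ) (k : Fin n) : Fin (2 * n) :=
  ⟨2 * (k : ℕ) + 1, by have := k.isLt; omega⟩

/-- The Pfaffian of a (skew-symmetric) `2n × 2n` matrix, defined as the sum over all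
perfect matchings: permutations `σ` with `σ(2k) < σ(2k+1)` and
`σ(0) < σ(2) < ⋯ < σ(2n-2)`, of `sign σ · ∏ₖ A (σ (2k)) (σ (2k+1))`. -/
def pf {R : Type*} [CommRing R] {n : ℕ} (A : Matrix (Fin (2 * n)) (Fin (2 * n)) R) : R :=
  ∑ σ ∈ Finset.univ.filter (fun σ : Equiv.Perm (Fin (2 * n)) =>
      (∀ k : Fin n, σ (fe n k) < σ (fo n k)) ∧
        ∀ k l : Fin n, k < l → σ (fe n k) < σ (fe n l)),
    ((Equiv.Perm.sign σ : ℤ) : R) * ∏ k : Fin n, A (σ (fe n k)) (σ (fo n k))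

/-! ### Sums over finite families -/

theorem hasSum_mul_of_summable_norm {ι κ : Type*} {f : ι → ℂ} {g : κ → ℂ} {s t : ℂ}
    (hf : Summable fun i => ‖f i‖) (hg : Summable fun i => ‖g i‖) (hs : HasSum f s)
    (ht : HasSum g t) : HasSum (fun x : ι × κ => f x.1 * g x.2) (s * t) :=
  hs.mul ht (summable_mul_of_summable_norm hf hg)

theorem summable_norm_and_hasSum_prod_pi {n : ℕ} {ι : Type*} (f : Fin n → ι → ℂ) (s : Fin n → ℂ)
    (hf : ∀ k, Summable fun m => ‖f k m‖) (hs : ∀ k, HasSum (f k) (s k)) :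
    (Summable fun m : Fin n → ι => ‖∏ k, f k (m k)‖) ∧
      HasSum (fun m : Fin n → ι => ∏ k, f k (m k)) (∏ k, s k) := by
  induction n with
  | zero =>
    constructor
    · exact (hasSum_fintype _).summable
    · simp [hasSum_unique]
  | succ n ih =>
    obtain ⟨h1, h2⟩ := ih (fun k => f k.succ) (fun k => s k.succ) (fun k => hf _) fun k => hs _
    constructor
    · rw [← (Fin.consEquiv fun _ : Fin (n + 1) => ι).summable_iff]
      refine (Summable.mul_norm (hf 0) h1).congr fun x => ?_
      simp [Fin.consEquiv, Fin.prod_univ_succ]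
    · rw [← (Fin.consEquiv fun _ : Fin (n + 1) => ι).hasSum_iff, Fin.prod_univ_succ]
      convert hasSum_mul_of_summable_norm (hf 0) h1 (hs 0) h2 using 1
      funext x
      simp [Fin.consEquiv, Fin.prod_univ_succ]

/-! ### Matchings and block permutations -/

/-- The splitting of `Fin (2 * n)` into `n` consecutive blocks of size two. -/
def blockEquiv (n : ℕ) : Fin n × Bool ≃ Fin (2 * n) where
  toFun p := if p.2 then fo n p.1 else fe n p.1
  invFun i := (⟨i / 2, by omega⟩, decide ((i : ℕ) % 2 = 1))
  left_inv := by
    rintro ⟨k, b⟩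
    cases b <;> simp [fo, fe, Fin.ext_iff]
    omega
  right_inv i := by
    rcases Nat.mod_two_eq_zero_or_one i with h | h <;> simp [fo, fe, Fin.ext_iff, h] <;> omega

@[simp] theorem blockEquiv_false (n : ℕ) (k : Fin n) : blockEquiv n (k, false) = fe n k := rfl

@[simp] theorem blockEquiv_true (n : ℕ) (k : Fin n) : blockEquiv n (k, true) = fo n k := rfl

/-- The permutation of `Fin (2 * n)` permuting the blocks by `h.1` after permuting each block
internally by `h.2`. -/
def blockPerm (n : ℕ) (h : Equiv.Perm (Fin n) × (Fin n → Equiv.Perm Bool)) :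
    Equiv.Perm (Fin (2 * n)) :=
  (blockEquiv n).permCongr (Equiv.prodCongrLeft (fun _ : Bool => h.1) * Equiv.prodCongrRight h.2)

theorem blockPerm_apply (n : ℕ) (h : Equiv.Perm (Fin n) × (Fin n → Equiv.Perm Bool))
    (k : Fin n) (b : Bool) :
    blockPerm n h (blockEquiv n (k, b)) = blockEquiv n (h.1 k, h.2 k b) := by
  simp [blockPerm, Equiv.permCongr_apply]

theorem blockPerm_symm_apply (n : ℕ) (h : Equiv.Perm (Fin n) × (Fin n → Equiv.Perm Bool))
    (k : Fin n) (b : Bool) :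
    (blockPerm n h)⁻¹ (blockEquiv n (h.1 k, b)) = blockEquiv n (k, (h.2 k)⁻¹ b) := by
  rw [Equiv.Perm.inv_eq_iff_eq, blockPerm_apply]
  simp

theorem sign_blockPerm (n : ℕ) (h : Equiv.Perm (Fin n) × (Fin n → Equiv.Perm Bool)) :
    Equiv.Perm.sign (blockPerm n h) = ∏ k, Equiv.Perm.sign (h.2 k) := by
  rw [blockPerm, Equiv.Perm.sign_permCongr, Equiv.Perm.sign_mul, Equiv.Perm.sign_prodCongrLeft,
    Equiv.Perm.sign_prodCongrRight]
  simp

theorem existsUnique_strictMono_comp_perm {n : ℕ} {α : Type*} [LinearOrder α] (f : Fin n → α)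
    (hf : Function.Injective f) : ∃! π : Equiv.Perm (Fin n), StrictMono (f ∘ π) := by
  refine ⟨Tuple.sort f, (Tuple.monotone_sort f).strictMono_of_injective
    (hf.comp (Equiv.injective _)), fun π hπ => ?_⟩
  ext k
  exact congrArg _ (hf (congrFun (Tuple.unique_monotone hπ.monotone (Tuple.monotone_sort f)) k))

theorem existsUnique_perm_bool {α : Type*} [LinearOrder α] (f : Bool → α)
    (hf : f false ≠ f true) : ∃! ε : Equiv.Perm Bool, f (ε false) < f (ε true) := by
  have key : ∀ ε : Equiv.Perm Bool, ε = 1 ∨ ε = Equiv.swap false true := by decide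
  rcases lt_or_gt_of_ne hf with h | h
  · refine ⟨1, by simpa using h, fun ε hε => ?_⟩
    rcases key ε with rfl | rfl
    · rfl
    · simp at hε
      exact absurd h hε.not_gt
  · refine ⟨Equiv.swap false true, by simpa using h, fun ε hε => ?_⟩
    rcases key ε with rfl | rfl
    · simp at hε
      exact absurd h hε.not_gt
    · rfl

/-- The permutations encoding perfect matchings of `Fin (2 * n)`. -/
def IsMatchingPerm (n : ℕ) (σ : Equiv.Perm (Fin (2 * n))) : Prop :=
  (∀ k : Fin n, σ (fe n k) < σ (fo n k)) ∧ ∀ k l : Fin n, k < l → σ (fe n k) < σ (fe n l)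

theorem existsUnique_isMatchingPerm_mul_blockPerm (n : ℕ) (σ : Equiv.Perm (Fin (2 * n))) :
    ∃! h, IsMatchingPerm n (σ * blockPerm n h) := by
  have h1 : ∀ j : Fin n, ∃! ε : Equiv.Perm Bool,
      σ (blockEquiv n (j, ε false)) < σ (blockEquiv n (j, ε true)) := fun j =>
    existsUnique_perm_bool (fun b => σ (blockEquiv n (j, b))) (by
      simp only [ne_eq, EmbeddingLike.apply_eq_iff_eq]
      simp)
  choose η hη hη' using h1
  obtain ⟨π, hπ, hπ'⟩ := existsUnique_strictMono_comp_perm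
    (fun j => σ (blockEquiv n (j, η j false)))
    (fun i j hij => by simpa using And.left (by simpa using hij))
  have expand : ∀ h, IsMatchingPerm n (σ * blockPerm n h) ↔
      (∀ k, σ (blockEquiv n (h.1 k, h.2 k false)) < σ (blockEquiv n (h.1 k, h.2 k true))) ∧
      StrictMono fun k => σ (blockEquiv n (h.1 k, h.2 k false)) := by
    intro h
    simp only [IsMatchingPerm, ← blockEquiv_false, ← blockEquiv_true, Equiv.Perm.mul_apply,
      blockPerm_apply]
    rfl
  refine ⟨(π, fun k => η (π k)), (expand _).2 ⟨fun k => hη _, hπ⟩, ?_⟩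
  rintro ⟨π', ε⟩ h
  obtain ⟨ha, hb⟩ := (expand _).1 h
  have hε : ε = fun k => η (π' k) := funext fun k => hη' (π' k) (ε k) (ha k)
  subst hε
  rw [hπ' π' hb]

open Classical in
/-- A sum over all permutations, grouped by the underlying perfect matching. -/
theorem sum_perm_eq_sum_matching {M : Type*} [AddCommMonoid M] (n : ℕ)
    (f : Equiv.Perm (Fin (2 * n)) → M) :
    ∑ σ, f σ = ∑ h, ∑ τ with IsMatchingPerm n τ, f (τ * (blockPerm n h)⁻¹) := by
  calc ∑ σ, f σ = ∑ σ, ∑ h, if IsMatchingPerm n (σ * blockPerm n h) then f σ else 0 := by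
        refine Finset.sum_congr rfl fun σ _ => ?_
        obtain ⟨h, hh, hu⟩ := existsUnique_isMatchingPerm_mul_blockPerm n σ
        rw [Finset.sum_eq_single h (fun b _ hb => if_neg fun hc => hb (hu b hc)) (by simp),
          if_pos hh]
    _ = _ := by
        rw [Finset.sum_comm]
        refine Finset.sum_congr rfl fun h _ => ?_
        rw [Finset.sum_filter, ← Equiv.sum_comp (Equiv.mulRight (blockPerm n h)) fun τ =>
          if IsMatchingPerm n τ then f (τ * (blockPerm n h)⁻¹) else 0]
        simp

open Classical in
theorem pf_eq_sum_isMatchingPerm {R : Type*} [CommRing R]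
    {n : ℕ} (A : Matrix (Fin (2 * n)) (Fin (2 * n)) R) :
    pf A = ∑ τ with IsMatchingPerm n τ, ((Equiv.Perm.sign τ : ℤ) : R) *
      ∏ k : Fin n, A (τ (fe n k)) (τ (fo n k)) := by
  unfold pf
  refine Finset.sum_congr ?_ fun _ _ => rfl
  ext σ
  simp only [Finset.mem_filter, Finset.mem_univ, true_and]
  rfl

open Classical in
/-- Expansion of a determinant whose columns come in pairs. -/
theorem det_blocks_eq_sum {R : Type*} [CommRing R] {n : ℕ} (u v : Fin n → Fin (2 * n) → R) :
    (Matrix.of fun i j : Fin (2 * n) =>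
      if ((blockEquiv n).symm j).2 then v ((blockEquiv n).symm j).1 i
        else u ((blockEquiv n).symm j).1 i).det =
    ∑ π : Equiv.Perm (Fin n), ∑ τ with IsMatchingPerm n τ, ((Equiv.Perm.sign τ : ℤ) : R) *
      ∏ k : Fin n, (u (π k) (τ (fe n k)) * v (π k) (τ (fo n k)) -
        v (π k) (τ (fe n k)) * u (π k) (τ (fo n k))) := by
  rw [Matrix.det_apply', sum_perm_eq_sum_matching, Fintype.sum_prod_type]
  refine Finset.sum_congr rfl fun π _ => ?_
  rw [Finset.sum_comm]
  refine Finset.sum_congr rfl fun τ _ => ?_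
  have hU : (Finset.univ : Finset (Equiv.Perm Bool)) = {1, Equiv.swap false true} := by decide
  have h1 : ∀ k : Fin n, u (π k) (τ (fe n k)) * v (π k) (τ (fo n k)) -
        v (π k) (τ (fe n k)) * u (π k) (τ (fo n k)) = ∑ ε : Equiv.Perm Bool,
        ((Equiv.Perm.sign ε : ℤ) : R) * (u (π k) (τ (blockEquiv n (k, ε⁻¹ false))) *
          v (π k) (τ (blockEquiv n (k, ε⁻¹ true)))) := by
    intro k
    rw [hU, Finset.sum_pair (by decide)]
    simp
    ring
  simp_rw [h1]
  rw [Finset.prod_univ_sum, Fintype.piFinset_univ, Finset.mul_sum]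
  refine Finset.sum_congr rfl fun ε _ => ?_
  rw [Equiv.Perm.sign_mul, Equiv.Perm.sign_inv, sign_blockPerm, Finset.prod_mul_distrib,
    ← (blockEquiv n).prod_comp, Fintype.prod_prod_type]
  have h2 : ∀ k b, (blockPerm n (π, ε))⁻¹ (blockEquiv n (π k, b)) = blockEquiv n (k, (ε k)⁻¹ b) :=
    blockPerm_symm_apply n (π, ε)
  simp only [Fintype.prod_bool, Matrix.of_apply, Equiv.symm_apply_apply, Equiv.Perm.mul_apply,
    if_true, Bool.false_eq_true, if_false, Units.val_mul, Units.coe_prod, Int.cast_mul,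
    Int.cast_prod, mul_assoc]
  congr 2
  rw [← Equiv.prod_comp π]
  simp only [h2]
  exact Finset.prod_congr rfl fun k _ => mul_comm _ _

/-! ### Minor summation -/

theorem hasSum_comp_perm {n : ℕ} {F : (Fin n → ℕ) → ℂ} {a : ℂ} (h : HasSum F a)
    (π : Equiv.Perm (Fin n)) : HasSum (fun m => F (m ∘ π)) a :=
  (π.symm.arrowCongr (Equiv.refl ℕ)).hasSum_iff.2 h

/-- A symmetric family vanishing on non-injective arguments sums to `n!` times its sum over
strictly decreasing arguments. -/
theorem hasSum_strictAnti_of_symmetric {n : ℕ} {G : (Fin n → ℕ) → ℂ} {a : ℂ}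
    (hG : HasSum G (n.factorial * a)) (hsymm : ∀ m (π : Equiv.Perm (Fin n)), G (m ∘ π) = G m)
    (hinj : ∀ m, ¬ Function.Injective m → G m = 0) :
    HasSum ({m | StrictAnti m}.indicator G) a := by
  classical
  have hs : Summable ({m | StrictAnti m}.indicator G) := hG.summable.indicator _
  obtain ⟨T, hT⟩ := hs
  have h1 : HasSum G (n.factorial * T) := by
    have h2 := hasSum_sum (s := Finset.univ) fun π (_ : π ∈ Finset.univ) => hasSum_comp_perm hT π
    simp only [Finset.sum_const, Finset.card_univ, Fintype.card_perm, Fintype.card_fin,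
      nsmul_eq_mul] at h2
    convert h2 using 1
    funext m
    by_cases hm : Function.Injective m
    · obtain ⟨π, hπ, hu⟩ := existsUnique_strictMono_comp_perm (OrderDual.toDual ∘ m) hm
      rw [Finset.sum_eq_single π]
      · rw [Set.indicator_of_mem, hsymm]
        exact hπ
      · intro ρ _ hρ
        exact Set.indicator_of_notMem (fun h => hρ (hu ρ h)) _
      · simp
    · rw [hinj m hm, Finset.sum_eq_zero]
      intro π _
      refine Set.indicator_of_notMem (fun h => hm ?_) _
      have := (StrictAnti.injective h).comp π.symm.injective
      simpa [Function.comp_assoc] using this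
  have h3 := mul_left_cancel₀ (Nat.cast_ne_zero.2 n.factorial_ne_zero) (h1.unique hG)
  rwa [← h3]

/-- The exponents `m 0 + 1, m 0, m 1 + 1, m 1, …`. -/
def pairedExponent {n : ℕ} (m : Fin n → ℕ) (j : Fin (2 * n)) : ℕ :=
  if ((blockEquiv n).symm j).2 then m ((blockEquiv n).symm j).1
    else m ((blockEquiv n).symm j).1 + 1

@[simp] theorem pairedExponent_fe {n : ℕ} (m : Fin n → ℕ) (k : Fin n) :
    pairedExponent m (fe n k) = m k + 1 := by
  simp [pairedExponent, ← blockEquiv_false]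

@[simp] theorem pairedExponent_fo {n : ℕ} (m : Fin n → ℕ) (k : Fin n) :
    pairedExponent m (fo n k) = m k := by
  simp [pairedExponent, ← blockEquiv_true]

/-- The summand of the minor summation formula. -/
def pairedMinor {n : ℕ} (x : Fin (2 * n) → ℂ) (t : ℂ) (m : Fin n → ℕ) : ℂ :=
  (∏ k, (1 - t ^ (m k + 1))) * (Matrix.of fun i j => x i ^ pairedExponent m j).det

theorem pairedMinor_eq_zero_of_pairedExponent_eq {n : ℕ} (x : Fin (2 * n) → ℂ) (t : ℂ)
    {m : Fin n → ℕ} {i j : Fin (2 * n)} (hij : i ≠ j)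
    (h : pairedExponent m i = pairedExponent m j) : pairedMinor x t m = 0 := by
  rw [pairedMinor, Matrix.det_zero_of_column_eq hij (fun k => by simp [h]), mul_zero]

theorem fe_injective (n : ℕ) : Function.Injective (fe n) := fun k l h => by
  simpa [fe, Fin.ext_iff] using h

theorem fe_ne_fo (n : ℕ) (k l : Fin n) : fe n k ≠ fo n l := fun h => by
  have := congrArg Fin.val h
  simp only [fe, fo] at this
  omega

/-- The coefficient of the skew form whose Pfaffian appears in the minor summation formula. -/
def pairedTerm (t a b : ℂ) (m : ℕ) : ℂ :=
  (1 - t ^ (m + 1)) * (a ^ (m + 1) * b ^ m - a ^ m * b ^ (m + 1))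

theorem pairedTerm_hasSum {t a b : ℂ} (ht : ‖t‖ < 1) (ha : ‖a‖ < 1) (hb : ‖b‖ < 1) :
    (Summable fun m => ‖pairedTerm t a b m‖) ∧
    HasSum (pairedTerm t a b) ((a - b) * (1 - t) / ((1 - a * b) * (1 - t * (a * b)))) := by
  have hab : ‖a * b‖ < 1 := by
    rw [norm_mul]
    exact mul_lt_one_of_nonneg_of_lt_one_left (norm_nonneg _) ha hb.le
  have htab : ‖t * (a * b)‖ < 1 := by
    rw [norm_mul]
    exact mul_lt_one_of_nonneg_of_lt_one_left (norm_nonneg _) ht hab.le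
  have h1 : 1 - a * b ≠ 0 := fun h => by
    rw [sub_eq_zero] at h
    simp [← h] at hab
  have h2 : 1 - t * (a * b) ≠ 0 := fun h => by
    rw [sub_eq_zero] at h
    simp [← h] at htab
  have h3 : HasSum (pairedTerm t a b)
      ((a - b) * (1 - t) / ((1 - a * b) * (1 - t * (a * b)))) := by
    have h4 : (a - b) * (1 - t) / ((1 - a * b) * (1 - t * (a * b))) =
        (a - b) * ((1 - a * b)⁻¹ - t * (1 - t * (a * b))⁻¹) := by
      rw [div_eq_iff (mul_ne_zero h1 h2)]
      linear_combination (-(a - b) * (1 - t * (a * b))) * inv_mul_cancel₀ h1 +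
        ((a - b) * t * (1 - a * b)) * inv_mul_cancel₀ h2
    have h5 : pairedTerm t a b =
        fun m => (a - b) * ((a * b) ^ m - t * (t * (a * b)) ^ m) := by
      funext m
      simp only [pairedTerm, mul_pow]
      ring
    rw [h4, h5]
    exact ((hasSum_geometric_of_norm_lt_one hab).sub
      ((hasSum_geometric_of_norm_lt_one htab).mul_left t)).mul_left (a - b)
  exact ⟨h3.summable.norm, h3⟩

open Classical in
/-- The minor summation formula for the determinants `pairedMinor`. -/
theorem hasSum_pairedMinor_strictAnti {n : ℕ} {x : Fin (2 * n) → ℂ} {t : ℂ}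
    (hx : ∀ i, ‖x i‖ < 1) (ht : ‖t‖ < 1) :
    HasSum ({m | StrictAnti m}.indicator (pairedMinor x t))
      (pf (Matrix.of fun i j : Fin (2 * n) =>
          (x i - x j) * (1 - t) / ((1 - x i * x j) * (1 - t * (x i * x j))))) := by
  set A := Matrix.of fun i j : Fin (2 * n) =>
          (x i - x j) * (1 - t) / ((1 - x i * x j) * (1 - t * (x i * x j))) with hA
  let P : (Fin n → ℕ) → ℂ := fun m => ∑ τ with IsMatchingPerm n τ,
    ((Equiv.Perm.sign τ : ℤ) : ℂ) * ∏ k, pairedTerm t (x (τ (fe n k))) (x (τ (fo n k))) (m k)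
  have hP : HasSum P (pf A) := by
    rw [pf_eq_sum_isMatchingPerm]
    refine hasSum_sum fun τ _ => HasSum.mul_left _ ?_
    exact (summable_norm_and_hasSum_prod_pi _ _ (fun k => (pairedTerm_hasSum ht (hx _) (hx _)).1)
      fun k => (pairedTerm_hasSum ht (hx _) (hx _)).2).2
  have hG : ∀ m, pairedMinor x t m = ∑ π : Equiv.Perm (Fin n), P (m ∘ π) := by
    intro m
    have := det_blocks_eq_sum (fun k i => x i ^ (m k + 1)) (fun k i => x i ^ (m k))
    rw [pairedMinor]
    have h2 : (Matrix.of fun i j => x i ^ pairedExponent m j) = Matrix.of fun i j : Fin (2 * n) =>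
      if ((blockEquiv n).symm j).2 then x i ^ m ((blockEquiv n).symm j).1
        else x i ^ (m ((blockEquiv n).symm j).1 + 1) := by
      ext i j
      simp only [Matrix.of_apply, pairedExponent]
      split_ifs <;> rfl
    rw [h2, this, Finset.mul_sum]
    refine Finset.sum_congr rfl fun π _ => ?_
    rw [Finset.mul_sum]
    refine Finset.sum_congr rfl fun τ _ => ?_
    simp only [pairedTerm, Finset.prod_mul_distrib, Function.comp_apply]
    rw [Equiv.prod_comp π fun k => 1 - t ^ (m k + 1)]
    ring
  refine hasSum_strictAnti_of_symmetric ?_ ?_ ?_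
  · have h2 := hasSum_sum (s := Finset.univ) fun π (_ : π ∈ Finset.univ) => hasSum_comp_perm hP π
    simp only [Finset.sum_const, Finset.card_univ, Fintype.card_perm, Fintype.card_fin,
      nsmul_eq_mul] at h2
    simpa only [← hG] using h2
  · intro m π
    rw [hG, hG]
    exact Fintype.sum_equiv (Equiv.mulLeft π) _ _ fun ρ => rfl
  · intro m hm
    obtain ⟨k, l, hkl, hne⟩ := Function.not_injective_iff.1 hm
    exact pairedMinor_eq_zero_of_pairedExponent_eq x t ((fe_injective n).ne hne) (by simp [hkl])

/-- Reindexing of the minor summation formula by partitions with repeated parts. -/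
theorem hasSum_pairedMinor_antitone {n : ℕ} {x : Fin (2 * n) → ℂ} {t : ℂ}
    (hx : ∀ i, ‖x i‖ < 1) (ht : ‖t‖ < 1) :
    HasSum ({ν : Fin n → ℕ | Antitone ν}.indicator fun ν =>
        pairedMinor x t fun k => ν k + (2 * n - (2 * (k : ℕ) + 2)))
      (pf (Matrix.of fun i j : Fin (2 * n) =>
          (x i - x j) * (1 - t) / ((1 - x i * x j) * (1 - t * (x i * x j))))) := by
  classical
  let φ : (Fin n → ℕ) → Fin n → ℕ := fun ν k => ν k + (2 * n - (2 * (k : ℕ) + 2))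
  have hφ : Function.Injective φ := fun ν ν' h => funext fun k => by
    have := congrFun h k
    simpa [φ] using this
  have gap : ∀ m : Fin n → ℕ, StrictAnti m → pairedMinor x t m ≠ 0 →
      Antitone (fun k => m k + 2 * (k : ℕ)) := by
    intro m hm h0
    cases n with
    | zero => exact fun k => k.elim0
    | succ n =>
      refine Fin.antitone_iff_succ_le.2 fun k => ?_
      have h1 : m k.succ < m k.castSucc := hm k.castSucc_lt_succ
      have h2 : m k.castSucc ≠ m k.succ + 1 := fun h =>
        h0 (pairedMinor_eq_zero_of_pairedExponent_eq x t (fe_ne_fo _ k.succ k.castSucc)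
          (by simp [h]))
      simp only [Fin.val_succ, Fin.val_castSucc]
      omega
  have key := hasSum_pairedMinor_strictAnti hx ht
  rw [← hφ.hasSum_iff] at key
  · convert key using 1
    funext ν
    simp only [Function.comp_apply, Set.indicator_apply, Set.mem_ofPred_eq]
    by_cases h1 : Antitone ν
    · have h2 : StrictAnti (φ ν) := fun k l hkl => by
        have := h1 hkl.le
        have : (k : ℕ) < l := hkl
        have := l.isLt
        simp only [φ]
        omega
      rw [if_pos h1, if_pos h2]
    · rw [if_neg h1]
      split_ifs with h2
      · by_contra h0
        refine h1 fun k l hkl => ?_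
        have := gap _ h2 (Ne.symm h0) hkl
        have : (k : ℕ) ≤ l := hkl
        have := l.isLt
        simp only [φ] at *
        omega
      · rfl
  · intro m hm
    rw [Set.indicator_apply]
    split_ifs with h
    · by_contra h0
      refine hm ⟨fun k => m k - (2 * n - (2 * (k : ℕ) + 2)), funext fun k => ?_⟩
      have hk := k.isLt
      have := gap m h h0 (show k ≤ ⟨n - 1, by omega⟩ from Fin.le_def.2 (by simp; omega))
      simp only [φ] at *
      omega
    · rfl

/-! ### The branching rule for bialternants -/

theorem det_eq_of_forall_col_eq_smul_add_succ {R : Type*} [CommRing R] {k : ℕ}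
    {A B : Matrix (Fin (k + 1)) (Fin (k + 1)) R} (c : Fin k → R)
    (hlast : ∀ i, A i (Fin.last k) = B i (Fin.last k))
    (hsucc : ∀ (i : Fin (k + 1)) (j : Fin k),
      A i j.castSucc = B i j.castSucc + c j * A i j.succ) : A.det = B.det := by
  rw [← Matrix.det_submatrix_equiv_self Fin.revPerm A,
    ← Matrix.det_submatrix_equiv_self Fin.revPerm B]
  refine Matrix.det_eq_of_forall_col_eq_smul_add_pred (fun j => c j.rev) (fun i => ?_) fun i j => ?_
  · simp [hlast]
  · simp [Fin.rev_succ, Fin.rev_castSucc, hsucc]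

theorem pow_sub_mul_pow_eq_mul_sum_Icc {R : Type*} [CommRing R] (x z : R) {a b : ℕ} (hab : a ≤ b)
    (e : ℕ) : x ^ (b + (e + 1)) - z ^ (b - a + 1) * x ^ (a + e) =
      (x - z) * ∑ p ∈ Finset.Icc a b, x ^ (p + e) * z ^ (b - p) := by
  obtain ⟨d, rfl⟩ := Nat.exists_eq_add_of_le hab
  have h := geom_sum₂_mul x z (d + 1)
  have h2 : ∑ p ∈ Finset.Icc a (a + d), x ^ (p + e) * z ^ (a + d - p) =
      x ^ (a + e) * ∑ i ∈ Finset.range (d + 1), x ^ i * z ^ (d + 1 - 1 - i) := by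
    rw [← Finset.Ico_add_one_right_eq_Icc, Finset.sum_Ico_eq_sum_range, Finset.mul_sum,
      show a + d + 1 - a = d + 1 by omega]
    refine Finset.sum_congr rfl fun i _ => ?_
    rw [show a + d - (a + i) = d + 1 - 1 - i by omega, show a + i + e = a + e + i by ring, pow_add]
    ring
  rw [h2, show a + d - a + 1 = d + 1 by omega, show a + d + (e + 1) = a + e + (d + 1) by ring,
    pow_add]
  linear_combination (-x ^ (a + e)) * h

/-- The alternant `det (yᵢ ^ (lⱼ + k - 1 - j))` in `k` variables. -/
def alternant {R : Type*} [CommRing R] {k : ℕ} (y : ℕ → R) (l : Fin k → ℕ) : R :=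
  (Matrix.of fun i j : Fin k => y i ^ (l j + (k - 1 - (j : ℕ)))).det

/-- The branching rule for alternants. -/
theorem alternant_succ {R : Type*} [CommRing R] {k : ℕ} (y : ℕ → R) {l : Fin (k + 1) → ℕ}
    (hl : Antitone l) :
    alternant y l = (∑ μ ∈ Fintype.piFinset fun j : Fin k => Finset.Icc (l j.succ) (l j.castSucc),
      y k ^ ((∑ j : Fin k, (l j.castSucc - μ j)) + l (Fin.last k)) * alternant y μ) *
        ∏ i : Fin k, (y i - y k) := by
  set A : Matrix (Fin (k + 1)) (Fin (k + 1)) R :=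
    Matrix.of fun i j => y i ^ (l j + (k + 1 - 1 - (j : ℕ))) with hA
  let c : Fin k → R := fun j => y k ^ (l j.castSucc - l j.succ + 1)
  let B : Matrix (Fin (k + 1)) (Fin (k + 1)) R := Matrix.of fun i j =>
    Fin.lastCases (motive := fun _ => R) (A i (Fin.last k))
      (fun j => A i j.castSucc - c j * A i j.succ) j
  have hle : ∀ j : Fin k, l j.succ ≤ l j.castSucc := fun j => hl j.castSucc_lt_succ.le
  have hAB : A.det = B.det := det_eq_of_forall_col_eq_smul_add_succ c
    (fun i => by simp [B]) fun i j => by simp [B]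
  have hB : ∀ (i : Fin (k + 1)) (j : Fin k), B i j.castSucc =
      (y i - y k) * ∑ p ∈ Finset.Icc (l j.succ) (l j.castSucc),
        y i ^ (p + (k - 1 - (j : ℕ))) * y k ^ (l j.castSucc - p) := by
    intro i j
    rw [← pow_sub_mul_pow_eq_mul_sum_Icc _ _ (hle j)]
    have hj := j.isLt
    simp only [B, A, c, Matrix.of_apply, Fin.lastCases_castSucc, Fin.val_castSucc, Fin.val_succ]
    rw [show k + 1 - 1 - (j : ℕ) = k - 1 - j + 1 by omega,
      show k + 1 - 1 - ((j : ℕ) + 1) = k - 1 - j by omega]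
  have hlast : B (Fin.last k) (Fin.last k) = y k ^ l (Fin.last k) := by simp [B, A]
  have hdet : B.det = y k ^ l (Fin.last k) * (Matrix.of fun i j : Fin k =>
      B i.castSucc j.castSucc).det := by
    rw [Matrix.det_succ_row B (Fin.last k), Fin.sum_univ_castSucc, Finset.sum_eq_zero, hlast]
    · simp only [Fin.succAbove_last, zero_add, Fin.val_last, Even.neg_one_pow ⟨k, rfl⟩, one_mul]
      rfl
    · intro j _
      rw [hB]
      simp
  have hmul : (Matrix.of fun i j : Fin k => B i.castSucc j.castSucc).det =
      (∏ i : Fin k, (y i - y k)) * (Matrix.of fun i j : Fin k =>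
        ∑ p ∈ Finset.Icc (l j.succ) (l j.castSucc),
          y i ^ (p + (k - 1 - (j : ℕ))) * y k ^ (l j.castSucc - p)).det := by
    rw [← Matrix.det_mul_column]
    congr 1
    ext i j
    simp [hB]
  have hsum : (Matrix.of fun i j : Fin k => ∑ p ∈ Finset.Icc (l j.succ) (l j.castSucc),
        y i ^ (p + (k - 1 - (j : ℕ))) * y k ^ (l j.castSucc - p)).det =
      ∑ μ ∈ Fintype.piFinset fun j : Fin k => Finset.Icc (l j.succ) (l j.castSucc),
        y k ^ (∑ j : Fin k, (l j.castSucc - μ j)) * alternant y μ := by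
    simp only [alternant, Matrix.det_apply', Matrix.of_apply, Finset.prod_univ_sum, Finset.mul_sum]
    rw [Finset.sum_comm]
    refine Finset.sum_congr rfl fun μ _ => Finset.sum_congr rfl fun σ _ => ?_
    rw [Finset.prod_mul_distrib, Finset.prod_pow_eq_pow_sum]
    ring
  rw [alternant, ← hA, hAB, hdet, hmul, hsum]
  simp only [pow_add, Finset.mul_sum, Finset.sum_mul]
  refine Finset.sum_congr rfl fun μ _ => ?_
  ring

/-! ### Interlacing sequences with a given last partition -/

theorem Interlace.antitone_left {m : ℕ} {a b : Fin m → ℕ} (h : Interlace a b) : Antitone a := by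
  cases m with
  | zero => exact fun k => k.elim0
  | succ m =>
    exact Fin.antitone_iff_succ_le.2 fun i => (h.2 i (by omega)).trans (h.1 i.castSucc)

theorem Interlace.antitone_right {m : ℕ} {a b : Fin m → ℕ} (h : Interlace a b) : Antitone b := by
  cases m with
  | zero => exact fun k => k.elim0
  | succ m =>
    exact Fin.antitone_iff_succ_le.2 fun i => (h.1 i.succ).trans (h.2 i (by omega))

open Classical in
/-- The partitions interlacing with `l` from below. -/
def interlacingBelow {N : ℕ} (l : Fin N → ℕ) : Finset (Fin N → ℕ) :=
  (Fintype.piFinset fun i => Finset.Iic (l i)).filter (Interlace l)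

theorem mem_interlacingBelow {N : ℕ} {l μ : Fin N → ℕ} :
    μ ∈ interlacingBelow l ↔ Interlace l μ := by
  simp only [interlacingBelow, Finset.mem_filter, Fintype.mem_piFinset, Finset.mem_Iic,
    and_iff_right_iff_imp]
  exact fun h => h.1

open Classical in
/-- The interlacing sequences of length `k` from the empty partition to `l`. -/
def chains {N : ℕ} : (k : ℕ) → (Fin N → ℕ) → Finset (Fin (k + 1) → Fin N → ℕ)
  | 0, l => if l = 0 then {fun _ => l} else ∅
  | k + 1, l => (interlacingBelow l).biUnion fun μ => (chains k μ).image fun L =>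
      Fin.snoc (α := fun _ => Fin N → ℕ) L l

theorem mem_chains {N k : ℕ} {l : Fin N → ℕ} {L : Fin (k + 1) → Fin N → ℕ} :
    L ∈ chains k l ↔ L 0 = 0 ∧ (∀ j : Fin k, Interlace (L j.succ) (L j.castSucc)) ∧
      L (Fin.last k) = l := by
  induction k generalizing l with
  | zero =>
    simp only [chains]
    constructor
    · intro h
      split_ifs at h with h0
      · rw [Finset.mem_singleton.1 h]
        exact ⟨h0, fun j => j.elim0, rfl⟩
      · simp at h
    · rintro ⟨h0, -, h1⟩
      have h2 : l = 0 := h1.symm.trans h0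
      rw [if_pos h2, Finset.mem_singleton]
      funext i
      rw [show i = Fin.last 0 by omega, h1]
  | succ k ih =>
    simp only [chains, Finset.mem_biUnion, Finset.mem_image, mem_interlacingBelow, ih]
    constructor
    · rintro ⟨μ, hμ, L', ⟨h0, h1, h2⟩, rfl⟩
      refine ⟨?_, fun j => ?_, by simp⟩
      · rw [← Fin.castSucc_zero, Fin.snoc_castSucc, h0]
      · refine Fin.lastCases ?_ (fun j => ?_) j
        · rw [Fin.succ_last, Fin.snoc_last, Fin.snoc_castSucc, h2]
          exact hμ
        · rw [← Fin.castSucc_succ, Fin.snoc_castSucc, Fin.snoc_castSucc]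
          exact h1 j
    · rintro ⟨h0, h1, h2⟩
      refine ⟨L (Fin.last k).castSucc, ?_, fun i => L i.castSucc, ⟨h0, fun j => ?_, rfl⟩, ?_⟩
      · rw [← h2, ← Fin.succ_last]
        exact h1 _
      · exact h1 j.castSucc
      · funext i
        refine Fin.lastCases ?_ (fun j => ?_) i
        · rw [Fin.snoc_last, h2]
        · rw [Fin.snoc_castSucc]

/-- The monomial recording the increments of the weights along a sequence. -/
def chainWeight {R : Type*} [CommRing R] (y : ℕ → R) {N k : ℕ} (L : Fin (k + 1) → Fin N → ℕ) : R :=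
  ∏ j : Fin k, y j ^ (wt (L j.succ) - wt (L j.castSucc))

theorem sum_chains_zero {R : Type*} [CommRing R] (y : ℕ → R) {N : ℕ} (l : Fin N → ℕ) :
    ∑ L ∈ chains 0 l, chainWeight y L = if l = 0 then 1 else 0 := by
  classical
  simp only [chains]
  split_ifs <;> simp [chainWeight]

theorem sum_chains_succ {R : Type*} [CommRing R] (y : ℕ → R) {N : ℕ} (k : ℕ) (l : Fin N → ℕ) :
    ∑ L ∈ chains (k + 1) l, chainWeight y L =
      ∑ μ ∈ interlacingBelow l, y k ^ (wt l - wt μ) * ∑ L ∈ chains k μ, chainWeight y L := by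
  classical
  simp only [chains]
  rw [Finset.sum_biUnion]
  · refine Finset.sum_congr rfl fun μ _ => ?_
    rw [Finset.sum_image fun L _ L' _ h => (Fin.snoc_injective2 h).1, Finset.mul_sum]
    refine Finset.sum_congr rfl fun L hL => ?_
    rw [chainWeight, Fin.prod_univ_castSucc, mul_comm]
    simp only [Fin.succ_last, Fin.snoc_last, Fin.snoc_castSucc, ← Fin.castSucc_succ,
      (mem_chains.1 hL).2.2]
    rfl
  · intro μ _ ν _ hne
    refine Finset.disjoint_left.2 fun L h1 h2 => hne ?_
    obtain ⟨L1, hL1, rfl⟩ := Finset.mem_image.1 h1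
    obtain ⟨L2, hL2, h⟩ := Finset.mem_image.1 h2
    have h3 : L2 = L1 := (Fin.snoc_injective2 h).1
    exact (mem_chains.1 hL1).2.2.symm.trans (h3 ▸ (mem_chains.1 hL2).2.2)

theorem sum_fin_eq_sum_castLE {M : Type*} [AddCommMonoid M] {k N : ℕ} (hk : k ≤ N) (f : Fin N → M)
    (hf : ∀ i : Fin N, k ≤ i → f i = 0) : ∑ i, f i = ∑ j : Fin k, f (Fin.castLE hk j) := by
  obtain ⟨r, rfl⟩ := Nat.exists_eq_add_of_le hk
  rw [Fin.sum_univ_add, Finset.sum_eq_zero fun i _ => hf (Fin.natAdd k i) (by simp), add_zero]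
  rfl

/-- The Vandermonde product in the first `k` variables of a sequence. -/
def vandermondeProd {R : Type*} [CommRing R] (y : ℕ → R) (k : ℕ) : R :=
  ∏ j ∈ Finset.range k, ∏ i ∈ Finset.range j, (y i - y j)

open Classical in
/-- The bialternant formula: the generating function of interlacing sequences ending at `l`. -/
theorem sum_chains_mul_vandermondeProd {R : Type*} [CommRing R] (y : ℕ → R) {N k : ℕ} (hk : k ≤ N)
    {l : Fin N → ℕ} (hl : Antitone l) :
    (∑ L ∈ chains k l, chainWeight y L) * vandermondeProd y k =
      if ∀ i : Fin N, k ≤ i → l i = 0 then alternant y fun j => l (Fin.castLE hk j) else 0 := by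
  induction k generalizing l with
  | zero =>
    rw [sum_chains_zero]
    simp [vandermondeProd, alternant, funext_iff]
  | succ k ih =>
    have hV : vandermondeProd y (k + 1) = vandermondeProd y k * ∏ i : Fin k, (y i - y k) := by
      rw [vandermondeProd, Finset.prod_range_succ, Fin.prod_univ_eq_prod_range fun i => y i - y k]
      rfl
    have hk' : k ≤ N := by omega
    have h1 : (∑ L ∈ chains (k + 1) l, chainWeight y L) * vandermondeProd y (k + 1) =
        (∑ μ ∈ interlacingBelow l with ∀ i : Fin N, k ≤ i → μ i = 0,
          y k ^ (wt l - wt μ) * alternant y fun j => μ (Fin.castLE hk' j)) *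
          ∏ i : Fin k, (y i - y k) := by
      rw [sum_chains_succ, hV, ← mul_assoc, Finset.sum_mul, Finset.sum_filter]
      congr 1
      refine Finset.sum_congr rfl fun μ hμ => ?_
      rw [mul_assoc, ih hk' (mem_interlacingBelow.1 hμ).antitone_right]
      split_ifs <;> simp
    rw [h1]
    split_ifs with h0
    · have hl' : Antitone fun j : Fin (k + 1) => l (Fin.castLE hk j) :=
        fun i j hij => hl (by simpa using hij)
      rw [alternant_succ y hl']
      congr 1
      refine Finset.sum_bij' (fun μ _ j => μ (Fin.castLE hk' j))
        (fun ν _ i => if h : (i : ℕ) < k then ν ⟨i, h⟩ else 0) ?_ ?_ ?_ ?_ ?_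
      · intro μ hμ
        obtain ⟨hi, hz⟩ := Finset.mem_filter.1 hμ
        rw [mem_interlacingBelow] at hi
        rw [Fintype.mem_piFinset]
        exact fun j => Finset.mem_Icc.2 ⟨hi.2 j (by omega), hi.1 _⟩
      · intro ν hν
        rw [Fintype.mem_piFinset] at hν
        simp only [Finset.mem_Icc] at hν
        refine Finset.mem_filter.2 ⟨mem_interlacingBelow.2 ⟨fun i => ?_, fun i h => ?_⟩,
          fun i hi => dif_neg hi.not_gt⟩
        · dsimp only
          split_ifs with h
          · exact (hν ⟨i, h⟩).2
          · exact Nat.zero_le _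
        · dsimp only
          split_ifs with h'
          · exact (hν ⟨i, h'⟩).1
          · exact (h0 _ (by simpa using h')).le
      · intro μ hμ
        funext i
        split_ifs with h
        · rfl
        · exact ((Finset.mem_filter.1 hμ).2 i (by omega)).symm
      · intro ν hν
        funext j
        simp
      · intro μ hμ
        obtain ⟨hi, hz⟩ := Finset.mem_filter.1 hμ
        rw [mem_interlacingBelow] at hi
        congr 2
        rw [wt, wt, sum_fin_eq_sum_castLE hk l h0, sum_fin_eq_sum_castLE hk' μ hz,
          Fin.sum_univ_castSucc]
        have h2 : ∑ j : Fin k, l (Fin.castLE hk j.castSucc) =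
            ∑ j : Fin k, (l (Fin.castLE hk j.castSucc) - μ (Fin.castLE hk' j)) +
              ∑ j : Fin k, μ (Fin.castLE hk' j) := by
          rw [← Finset.sum_add_distrib]
          exact Finset.sum_congr rfl fun j _ => (Nat.sub_add_cancel (hi.1 (Fin.castLE hk' j))).symm
        rw [h2]
        dsimp only
        omega
    · rw [Finset.sum_eq_zero, zero_mul]
      intro μ hμ
      obtain ⟨hi, hz⟩ := Finset.mem_filter.1 hμ
      rw [mem_interlacingBelow] at hi
      refine absurd (fun i hki => ?_) h0
      obtain ⟨i, hiN⟩ := i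
      obtain ⟨i, rfl⟩ : ∃ i', i = i' + 1 := ⟨i - 1, by simp at hki; omega⟩
      have h3 := hi.2 i hiN
      rw [hz ⟨i, by omega⟩ (by simpa using hki)] at h3
      omega

/-! ### Convergence and the final summation -/

theorem sum_sub_castSucc {k : ℕ} (g : Fin (k + 1) → ℕ)
    (hg : ∀ j : Fin k, g j.castSucc ≤ g j.succ) :
    ∑ j : Fin k, (g j.succ - g j.castSucc) + g 0 = g (Fin.last k) := by
  induction k with
  | zero => simp
  | succ k ih =>
    have h1 := ih (fun j => g j.castSucc) fun j => hg j.castSucc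
    have h2 := hg (Fin.last k)
    simp only [Fin.castSucc_zero, ← Fin.succ_castSucc] at h1
    rw [Fin.sum_univ_castSucc]
    simp only [Fin.succ_last, Nat.succ_eq_add_one] at h2 ⊢
    omega

theorem summable_prod_prod_pow (M N : ℕ) {ρ : ℝ} (h0 : 0 ≤ ρ) (h1 : ρ < 1) :
    Summable fun L : Fin M → Fin N → ℕ => ∏ k, ∏ i, ρ ^ L k i := by
  have ha : Summable fun m : ℕ => ‖(ρ : ℂ) ^ m‖ := by
    simpa [abs_of_nonneg h0] using summable_geometric_of_lt_one h0 h1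
  have hb := summable_norm_and_hasSum_prod_pi (fun (_ : Fin N) m => (ρ : ℂ) ^ m) _
    (fun _ => ha) fun _ => ha.of_norm.hasSum
  have hc := summable_norm_and_hasSum_prod_pi
    (fun (_ : Fin M) (μ : Fin N → ℕ) => ∏ i, (ρ : ℂ) ^ μ i) _ (fun _ => hb.1)
    fun _ => hb.1.of_norm.hasSum
  simpa [abs_of_nonneg h0] using hc.1

/-- The summand, for an arbitrary array of integers. -/
def chainTerm (n : ℕ) (x : Fin (2 * n) → ℂ) (t : ℂ) (L : Fin (2 * n + 1) → Fin (2 * n) → ℕ) : ℂ :=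
  (∏ k : Fin n, (1 - t ^ (L (Fin.last (2 * n)) (fo n k) + (2 * n - (2 * (k : ℕ) + 1))))) *
    ∏ j : Fin (2 * n), x j ^ (wt (L j.succ) - wt (L j.castSucc))

theorem norm_chainTerm_le {n : ℕ} {x : Fin (2 * n) → ℂ} {t : ℂ} {ρ : ℝ} (h0 : 0 ≤ ρ) (h1 : ρ ≤ 1)
    (hx : ∀ i, ‖x i‖ ≤ ρ ^ (2 * n + 1)) (ht : ‖t‖ ≤ 1) {L : Fin (2 * n + 1) → Fin (2 * n) → ℕ}
    (hL0 : L 0 = fun _ => 0) (hL : ∀ k : Fin (2 * n), Interlace (L k.succ) (L k.castSucc)) :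
    ‖chainTerm n x t L‖ ≤ 2 ^ n * ∏ k, ∏ i, ρ ^ L k i := by
  rw [chainTerm, norm_mul, norm_prod, norm_prod]
  refine mul_le_mul ?_ ?_ (Finset.prod_nonneg fun _ _ => norm_nonneg _) (by positivity)
  · calc _ ≤ ∏ _k : Fin n, (2 : ℝ) := by
          refine Finset.prod_le_prod (fun _ _ => norm_nonneg _) fun k _ => ?_
          refine (norm_sub_le _ _).trans ?_
          rw [norm_one, norm_pow]
          linarith [pow_le_one₀ (n := L (Fin.last (2 * n)) (fo n k) + (2 * n - (2 * (k : ℕ) + 1)))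
            (norm_nonneg t) ht]
      _ = 2 ^ n := by simp
  · have hmono : ∀ i, Monotone fun k => L k i := fun i =>
      Fin.monotone_iff_le_succ.2 fun k => (hL k).1 i
    have hwt : ∑ j : Fin (2 * n), (wt (L j.succ) - wt (L j.castSucc)) = wt (L (Fin.last _)) := by
      rw [← sum_sub_castSucc (fun k => wt (L k)) fun j => Finset.sum_le_sum fun i _ => (hL j).1 i]
      simp [hL0, wt]
    calc _ ≤ ∏ j : Fin (2 * n), (ρ ^ (2 * n + 1)) ^ (wt (L j.succ) - wt (L j.castSucc)) := by
          refine Finset.prod_le_prod (fun _ _ => norm_nonneg _) fun j _ => ?_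
          rw [norm_pow]
          exact pow_le_pow_left₀ (norm_nonneg _) (hx j) _
      _ = ρ ^ ((2 * n + 1) * wt (L (Fin.last _))) := by
          rw [Finset.prod_pow_eq_pow_sum, hwt, pow_mul]
      _ ≤ ρ ^ (∑ k, ∑ i, L k i) := by
          refine pow_le_pow_of_le_one h0 h1 ?_
          calc ∑ k, ∑ i, L k i ≤ ∑ _k : Fin (2 * n + 1), wt (L (Fin.last _)) :=
                Finset.sum_le_sum fun k _ => Finset.sum_le_sum fun i _ => hmono i (Fin.le_last k)
            _ = _ := by simp
      _ = _ := by simp only [Finset.prod_pow_eq_pow_sum]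

/-- The extension of a finite family by zero. -/
def extendZero {N : ℕ} (x : Fin N → ℂ) (j : ℕ) : ℂ := if h : j < N then x ⟨j, h⟩ else 0

@[simp] theorem extendZero_val {N : ℕ} (x : Fin N → ℂ) (i : Fin N) : extendZero x i = x i := by
  simp [extendZero]

theorem vandermondeProd_extendZero {N : ℕ} (x : Fin N → ℂ) :
    vandermondeProd (extendZero x) N = vprod x := by
  have h1 : vprod x = ∏ j : Fin N, ∏ i ∈ Finset.Iio j, (x i - x j) := by
    rw [vprod]
    exact Finset.prod_comm' (by simp)
  rw [h1, vandermondeProd, ← Fin.prod_univ_eq_prod_range fun j =>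
    ∏ i ∈ Finset.range j, (extendZero x i - extendZero x j)]
  refine Finset.prod_congr rfl fun j _ => ?_
  refine (Finset.prod_nbij (fun i : Fin N => (i : ℕ)) ?_ ?_ ?_ ?_).symm
  · intro i hi
    simpa using hi
  · exact fun i _ i' _ h => Fin.ext h
  · intro i hi
    have hi' : i < j := by simpa using hi
    exact ⟨⟨i, hi'.trans j.isLt⟩, by simpa [Fin.lt_def] using hi', rfl⟩
  · intro i _
    simp

theorem vprod_ne_zero {N : ℕ} {x : Fin N → ℂ} (hx : Function.Injective x) : vprod x ≠ 0 :=
  Finset.prod_ne_zero_iff.2 fun _ _ => Finset.prod_ne_zero_iff.2 fun _ hj =>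
    sub_ne_zero.2 (hx.ne (Finset.mem_Ioi.1 hj).ne)

/-- The partition in which every part of `ν` is repeated twice. -/
def doubled {n : ℕ} (ν : Fin n → ℕ) (j : Fin (2 * n)) : ℕ := ν ((blockEquiv n).symm j).1

@[simp] theorem doubled_fe {n : ℕ} (ν : Fin n → ℕ) (k : Fin n) : doubled ν (fe n k) = ν k := by
  simp [doubled, ← blockEquiv_false]

@[simp] theorem doubled_fo {n : ℕ} (ν : Fin n → ℕ) (k : Fin n) : doubled ν (fo n k) = ν k := by
  simp [doubled, ← blockEquiv_true]

theorem forall_fin_two_mul {n : ℕ} {p : Fin (2 * n) → Prop} :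
    (∀ j, p j) ↔ (∀ k, p (fe n k)) ∧ ∀ k, p (fo n k) := by
  rw [← (blockEquiv n).forall_congr_right, Prod.forall]
  simp [Bool.forall_bool, forall_and]

theorem antitone_doubled {n : ℕ} {ν : Fin n → ℕ} (h : Antitone ν) : Antitone (doubled ν) :=
  fun _ _ hij => h (Fin.le_def.2 (Nat.div_le_div_right hij))

theorem sum_chainTerm {n : ℕ} {x : Fin (2 * n) → ℂ} (t : ℂ) (hx : Function.Injective x)
    {ν : Fin n → ℕ} (hν : Antitone ν) :
    ∑ L ∈ chains (2 * n) (doubled ν), chainTerm n x t L =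
      (vprod x)⁻¹ * pairedMinor x t fun k => ν k + (2 * n - (2 * (k : ℕ) + 2)) := by
  classical
  have h1 := sum_chains_mul_vandermondeProd (extendZero x) le_rfl (antitone_doubled hν)
  rw [if_pos fun i hi => absurd i.isLt hi.not_gt, vandermondeProd_extendZero] at h1
  have h2 : (alternant (extendZero x) fun j : Fin (2 * n) => doubled ν (Fin.castLE le_rfl j)) =
      (Matrix.of fun i j => x i ^ pairedExponent
        (fun k : Fin n => ν k + (2 * n - (2 * (k : ℕ) + 2))) j).det := by
    rw [alternant]
    congr 1
    refine Matrix.ext fun i => ?_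
    simp only [Matrix.of_apply, extendZero_val, Fin.castLE_rfl, id]
    refine forall_fin_two_mul.2 ⟨fun k => ?_, fun k => ?_⟩
    · have := k.isLt
      congr 1
      rw [doubled_fe, pairedExponent_fe]
      simp only [fe]
      omega
    · have := k.isLt
      congr 1
      rw [doubled_fo, pairedExponent_fo]
      simp only [fo]
      omega
  have h3 : ∀ L ∈ chains (2 * n) (doubled ν), chainTerm n x t L =
      (∏ k : Fin n, (1 - t ^ (ν k + (2 * n - (2 * (k : ℕ) + 2)) + 1))) *
        chainWeight (extendZero x) L := by
    intro L hL
    simp only [chainTerm, chainWeight, (mem_chains.1 hL).2.2, doubled_fo, extendZero_val]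
    congr 1
    refine Finset.prod_congr rfl fun k _ => ?_
    have := k.isLt
    congr 2
    omega
  rw [Finset.sum_congr rfl h3, ← Finset.mul_sum, pairedMinor, ← h2, ← h1]
  have := vprod_ne_zero hx
  field_simp

theorem antitone_of_mem_chains {k N : ℕ} {l : Fin N → ℕ} {L : Fin (k + 1) → Fin N → ℕ}
    (hL : L ∈ chains k l) (j : Fin (k + 1)) : Antitone (L j) := by
  obtain ⟨h0, h1, -⟩ := mem_chains.1 hL
  refine Fin.cases ?_ (fun j => (h1 j).antitone_left) j
  rw [h0]
  exact antitone_const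

theorem monotone_fo (n : ℕ) : Monotone (fo n) := by
  intro k l hkl
  have : (k : ℕ) ≤ l := hkl
  simp only [fo, Fin.le_def]
  omega

theorem exists_le_pow_of_lt_one {r : ℝ} (h0 : 0 ≤ r) (h1 : r < 1) {m : ℕ} (hm : m ≠ 0) :
    ∃ ρ : ℝ, 0 ≤ ρ ∧ ρ < 1 ∧ r = ρ ^ m :=
  ⟨r ^ (m : ℝ)⁻¹, Real.rpow_nonneg h0 _,
    Real.rpow_lt_one h0 h1 (by positivity), (Real.rpow_inv_natCast_pow h0 hm).symm⟩

/-- The sequences of partitions over which the series runs. -/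
abbrev SymmetricChain (n : ℕ) : Type :=
  {L : Fin (2 * n + 1) → Fin (2 * n) → ℕ //
    (∀ k, Antitone (L k)) ∧ L 0 = (fun _ => 0) ∧
    (∀ k : Fin (2 * n), Interlace (L k.succ) (L k.castSucc)) ∧
    ∀ k : Fin n, L (Fin.last (2 * n)) (fe n k) = L (Fin.last (2 * n)) (fo n k)}

/-- The parts of the central partition, each pair of equal parts being recorded once. -/
def SymmetricChain.half {n : ℕ} (L : SymmetricChain n) (k : Fin n) : ℕ :=
  L.1 (Fin.last (2 * n)) (fo n k)

theorem SymmetricChain.antitone_half {n : ℕ} (L : SymmetricChain n) : Antitone L.half :=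
  (L.2.1 _).comp_monotone (monotone_fo n)

theorem SymmetricChain.last_eq_doubled {n : ℕ} (L : SymmetricChain n) :
    L.1 (Fin.last (2 * n)) = doubled L.half := by
  refine funext (forall_fin_two_mul.2 ⟨fun k => ?_, fun k => ?_⟩)
  · rw [doubled_fe, L.2.2.2.2 k, half]
  · rw [doubled_fo, half]

/-- The sequences with a given central partition are those enumerated by `chains`. -/
def SymmetricChain.fiberEquiv {n : ℕ} (ν : Fin n → ℕ) :
    {L : SymmetricChain n // L.half = ν} ≃ chains (2 * n) (doubled ν) where
  toFun c := ⟨c.1.1, mem_chains.2 ⟨c.1.2.2.1, c.1.2.2.2.1, by rw [c.1.last_eq_doubled, c.2]⟩⟩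
  invFun L := ⟨⟨L.1, antitone_of_mem_chains L.2, (mem_chains.1 L.2).1, (mem_chains.1 L.2).2.1,
    fun k => by simp [(mem_chains.1 L.2).2.2]⟩,
    funext fun k => by simp [half, (mem_chains.1 L.2).2.2]⟩
  left_inv _ := rfl
  right_inv _ := rfl

theorem SymmetricChain.hasSum_fiber {n : ℕ} {x : Fin (2 * n) → ℂ} (t : ℂ)
    (hx : Function.Injective x) (g : (Fin n → ℕ) → ℂ)
    (hg : ∀ ν : Fin n → ℕ, g ν = pairedMinor x t fun k => ν k + (2 * n - (2 * (k : ℕ) + 2)))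
    (ν : Fin n → ℕ) :
    HasSum (fun L : {L : SymmetricChain n // L.half = ν} => chainTerm n x t L.1.1)
      ((vprod x)⁻¹ * {ν : Fin n → ℕ | Antitone ν}.indicator g ν) := by
  by_cases hν : Antitone ν
  · rw [Set.indicator_of_mem (s := {ν : Fin n → ℕ | Antitone ν}) hν, hg, ← sum_chainTerm t hx hν]
    have h : HasSum (fun L : chains (2 * n) (doubled ν) => chainTerm n x t L) _ :=
      Finset.hasSum (chains (2 * n) (doubled ν)) (chainTerm n x t)
    rw [← (fiberEquiv ν).hasSum_iff] at h
    exact h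
  · rw [Set.indicator_of_notMem (s := {ν : Fin n → ℕ | Antitone ν}) hν, mul_zero]
    have : IsEmpty {L : SymmetricChain n // L.half = ν} := ⟨fun c => hν (c.2 ▸ c.1.antitone_half)⟩
    exact hasSum_empty

theorem SymmetricChain.summable_chainTerm {n : ℕ} {x : Fin (2 * n) → ℂ} {t : ℂ} {ρ : ℝ}
    (h0 : 0 ≤ ρ) (h1 : ρ < 1) (hx : ∀ i, ‖x i‖ ≤ ρ ^ (2 * n + 1)) (ht : ‖t‖ ≤ 1) :
    Summable fun L : SymmetricChain n => chainTerm n x t L.1 :=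
  Summable.of_norm_bounded
    (((summable_prod_prod_pow (2 * n + 1) (2 * n) h0 h1).mul_left (2 ^ n)).comp_injective
      Subtype.val_injective)
    fun L => norm_chainTerm_le h0 h1.le hx ht L.2.2.1 L.2.2.2.1

/-- **Refined generating series of symmetric plane partitions** (the plane-partition form
of Theorem 4): summing over interlacing sequences
`∅ = λ⁽⁰⁾ ≺ λ⁽¹⁾ ≺ ⋯ ≺ λ⁽²ⁿ⁾` whose central partition has even conjugate
(`λ⁽²ⁿ⁾_{2k-1} = λ⁽²ⁿ⁾_{2k}`), i.e. over symmetric plane partitions in the `2n × 2n` box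
recorded by one half of their diagonal slices,
`Σ ∏_{i=2,4,…,2n} (1-t^{λ⁽²ⁿ⁾ᵢ-i+2n+1}) ∏ⱼ xⱼ^{|λ⁽ʲ⁾|-|λ⁽ʲ⁻¹⁾|}
  = Δ(x)_{2n}⁻¹ · Pf[(xᵢ-xⱼ)(1-t)/((1-xᵢxⱼ)(1-t xᵢxⱼ))]`.
It is stated here for complex values of the variables in a domain of convergence. -/
theorem refined_symmetric_plane_partition_series (n : ℕ) (hn : 1 ≤ n)
    (x : Fin (2 * n) → ℂ) (t : ℂ)
    (hx : ∀ i, ‖x i‖ < 1 / (16 * n)) (ht : ‖t‖ < 1) (hxinj : Function.Injective x) :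
    HasSum
      (fun L : {L : Fin (2 * n + 1) → Fin (2 * n) → ℕ //
          (∀ k, Antitone (L k)) ∧ L 0 = (fun _ => 0) ∧
          (∀ k : Fin (2 * n), Interlace (L k.succ) (L k.castSucc)) ∧
          ∀ k : Fin n, L (Fin.last (2 * n)) (fe n k) = L (Fin.last (2 * n)) (fo n k)} =>
        (∏ k : Fin n,
            (1 - t ^ (L.1 (Fin.last (2 * n)) (fo n k) + (2 * n - (2 * (k : ℕ) + 1))))) *
          ∏ j : Fin (2 * n), x j ^ (wt (L.1 j.succ) - wt (L.1 j.castSucc)))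
      ((vprod x)⁻¹ *
        pf (Matrix.of fun i j : Fin (2 * n) =>
          (x i - x j) * (1 - t) / ((1 - x i * x j) * (1 - t * (x i * x j))))) := by
  obtain ⟨ρ, hρ0, hρ1, hρx⟩ : ∃ ρ : ℝ, 0 ≤ ρ ∧ ρ < 1 ∧ ∀ i, ‖x i‖ ≤ ρ ^ (2 * n + 1) := by
    have hn' : (1 : ℝ) ≤ n := by exact_mod_cast hn
    obtain ⟨ρ, h0, h1, h2⟩ := exists_le_pow_of_lt_one (r := 1 / (16 * n)) (by positivity)
      (by rw [div_lt_one (by positivity)]; linarith) (Nat.succ_ne_zero (2 * n))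
    exact ⟨ρ, h0, h1, fun i => h2 ▸ (hx i).le⟩
  have hx1 : ∀ i, ‖x i‖ < 1 := fun i => (hρx i).trans_lt (pow_lt_one₀ hρ0 hρ1 (by omega))
  change HasSum (fun L : SymmetricChain n => chainTerm n x t L.1) _
  rw [← (Equiv.sigmaFiberEquiv SymmetricChain.half).hasSum_iff]
  exact HasSum.sigma_of_hasSum ((hasSum_pairedMinor_antitone hx1 ht).mul_left _)
    (SymmetricChain.hasSum_fiber t hxinj _ fun _ => rfl) ((Equiv.sigmaFiberEquiv _).summable_iff.2
      (SymmetricChain.summable_chainTerm hρ0 hρ1 hρx ht.le))
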